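/- For every integer n ≥ 1, the numbers of 20V configurations with DWBC3 on triangles of consecutive sizes satisfy Z_{2n}^{20V3} = 2^n · Z_{2n−1}^{20V3}. -/

import Mathlib

open Real

namespace TwentyV

/-- The three edge directions of the triangular lattice: `(1,0)`, `(0,1)`, `(1,-1)`. -/
def dir : Fin 3 → ℤ × ℤ := ![(1, 0), (0, 1), (1, -1)]

/-- The triangular domain `T_m`: vertices `(x,y)` with `x ≤ 0`, `y ≤ m-1`, `x+y ≥ 0`. -/
def Tri (m : ℕ) : Set (ℤ × ℤ) := {v | v.1 ≤ 0 ∧ v.2 ≤ (m : ℤ) - 1 ∧ 0 ≤ v.1 + v.2}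

/-- An orientation of the edges of the triangular lattice: the edge joining `v` and
`v + dir d` is recorded at base point `v`, and the value `true` means that it is
oriented from `v` towards `v + dir d`. -/
abbrev Orientation := ℤ × ℤ → Fin 3 → Bool

/-- The edge `(v, d)` is incident to the triangle `T_m`. -/
def Incident (m : ℕ) (v : ℤ × ℤ) (d : Fin 3) : Prop := v ∈ Tri m ∨ v + dir d ∈ Tri m

/-- The number of edges incoming at the vertex `u`. -/
def inDeg (o : Orientation) (u : ℤ × ℤ) : ℕ :=
  (Finset.univ.filter fun d : Fin 3 => o (u - dir d) d = true).card +
    (Finset.univ.filter fun d : Fin 3 => o u d = false).card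

/-- Ice rule: every vertex of `T_m` has exactly three incoming (hence three
outgoing) incident edges. -/
def IceRule (m : ℕ) (o : Orientation) : Prop := ∀ u ∈ Tri m, inDeg o u = 3

/-- DWBC3 boundary conditions on `T_m`: all East boundary half-edges (at vertices
`(0,y)`) point into the domain, all North boundary half-edges (at vertices
`(x,m-1)`) point out of the domain, and the diagonal boundary half-edges (at
vertices `(-y,y)`) point into the domain on the upper half and out of it on the
lower half (for odd `m` the central vertex gets one incoming and one outgoing
half-edge).  In addition, all edges not incident to `T_m` are normalized to
`true`, so that the set of configurations is finite. -/
def DWBC3 (m : ℕ) (o : Orientation) : Prop :=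
  (∀ y : ℤ, 0 ≤ y → y ≤ (m : ℤ) - 1 → o (0, y) 0 = false ∧ o (0, y) 2 = false) ∧
  (∀ x : ℤ, 1 - (m : ℤ) ≤ x → x ≤ 0 →
      o (x, (m : ℤ) - 1) 1 = true ∧ o (x - 1, (m : ℤ)) 2 = false) ∧
  (∀ y : ℤ, 0 ≤ y → y ≤ (m : ℤ) - 1 →
      (o (-y - 1, y) 0 = true ↔ (m : ℤ) - 1 ≤ 2 * y) ∧
      (o (-y, y - 1) 1 = true ↔ (m : ℤ) ≤ 2 * y)) ∧
  (∀ v d, ¬ Incident m v d → o v d = true)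

/-- The set of 20V configurations with DWBC3 on `T_m`. -/
def Config (m : ℕ) : Set Orientation := {o | IceRule m o ∧ DWBC3 m o}

/-- `Z_m^{20V3}`: the number of 20V configurations with DWBC3 on `T_m`. -/
noncomputable def Z (m : ℕ) : ℕ := (Config m).ncard

end TwentyV

namespace TwentyV

noncomputable section Algebra

/-- 20V vertex weight: `e n d` are the values on the E, N, SE legs, the others on S, W, NW. -/
def V (s w d e n d' : Bool) : ℝ :=
  if e.toNat + n.toNat + d.toNat = s.toNat + w.toNat + d'.toNat then 1 else 0

/-- 6V weight (horizontal/vertical crossing). -/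
def X6 (s w q p : Bool) : ℝ :=
  if q.toNat + p.toNat = s.toNat + w.toNat then (if q = p then √2 else 1) else 0

/-- 6V weight of the diagonal line crossing a horizontal (`t = true`) or a vertical
(`t = false`) line; `b` is the outgoing value, `c` the incoming one. -/
def M6 (t b d c d' : Bool) : ℝ :=
  if c.toNat + d.toNat = b.toNat + d'.toNat then
    (if t then (if c = d then 1 else √2 / 2) else (if c ≠ d ∧ b = c then 1 else √2 / 2))
  else 0

theorem sq2 : √2 * √2 = (2 : ℝ) := Real.mul_self_sqrt (by norm_num)

theorem V_eq (s w d e n d' : Bool) :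
    ∑ q, ∑ p, ∑ d1, X6 s w q p * M6 true q d e d1 * M6 false p d1 n d' = V s w d e n d' := by
  have h := sq2
  cases s <;> cases w <;> cases d <;> cases e <;> cases n <;> cases d' <;>
    simp [V, X6, M6] <;> linarith

theorem V_eq' (s w d e n d' : Bool) :
    ∑ s', ∑ w', ∑ d1, M6 false s d s' d1 * M6 true w d1 w' d' * X6 s' w' e n
      = V s w d e n d' := by
  have h := sq2
  cases s <;> cases w <;> cases d <;> cases e <;> cases n <;> cases d' <;>
    simp [V, X6, M6] <;> linarith

/-- 20V layer operator. -/
def T20 : Bool → (List Bool → ℝ) → List Bool → ℝ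
  | d, F, [] => if d = false then F [] else 0
  | _, _, [_] => 0
  | d, F, s :: w :: l =>
      ∑ e, ∑ n, ∑ d', V s w d e n d' * T20 d' (fun l => F (e :: n :: l)) l

/-- 6V layer operator. -/
def XL : (List Bool → ℝ) → List Bool → ℝ
  | F, [] => F []
  | _, [_] => 0
  | F, s :: w :: l => ∑ q, ∑ p, X6 s w q p * XL (fun l => F (q :: p :: l)) l

/-- Diagonal line operator. -/
def DL : Bool → Bool → (List Bool → ℝ) → List Bool → ℝ
  | _, d, F, [] => if d = false then F [] else 0
  | t, d, F, b :: l => ∑ c, ∑ d', M6 t b d c d' * DL (!t) d' (fun l => F (c :: l)) l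

theorem XL_add (F G : List Bool → ℝ) (l : List Bool) :
    XL (fun l => F l + G l) l = XL F l + XL G l := by
  induction l using List.twoStepInduction generalizing F G with
  | nil => simp [XL]
  | singleton => simp [XL]
  | cons_cons s w l ih _ =>
    simp only [XL, Fintype.sum_bool, ih]; ring

theorem XL_smul (a : ℝ) (F : List Bool → ℝ) (l : List Bool) :
    XL (fun l => a * F l) l = a * XL F l := by
  induction l using List.twoStepInduction generalizing F with
  | nil => simp [XL]
  | singleton => simp [XL]
  | cons_cons s w l ih _ =>
    simp only [XL, Fintype.sum_bool, ih]; ring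

theorem DL_add (t d : Bool) (F G : List Bool → ℝ) (l : List Bool) :
    DL t d (fun l => F l + G l) l = DL t d F l + DL t d G l := by
  induction l generalizing t d F G with
  | nil => simp only [DL]; split_ifs <;> simp
  | cons b l ih => simp only [DL, Fintype.sum_bool, ih]; ring

theorem DL_smul (t d : Bool) (a : ℝ) (F : List Bool → ℝ) (l : List Bool) :
    DL t d (fun l => a * F l) l = a * DL t d F l := by
  induction l generalizing t d F with
  | nil => simp only [DL]; split_ifs <;> simp
  | cons b l ih => simp only [DL, Fintype.sum_bool, ih]; ring

theorem T20_eq (d : Bool) (F : List Bool → ℝ) (l : List Bool) :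
    T20 d F l = XL (DL true d F) l := by
  induction l using List.twoStepInduction generalizing d F with
  | nil => simp [XL, T20, DL]
  | singleton => simp [XL, T20]
  | cons_cons s w l ih _ =>
    have h := V_eq s w d
    simp only [Fintype.sum_bool] at h
    simp only [XL, T20, DL, Fintype.sum_bool, ih, XL_add, XL_smul, Bool.not_true, Bool.not_false,
      ← h]
    ring

theorem DL_XL (d : Bool) (F : List Bool → ℝ) (l : List Bool) :
    DL false d (XL F) l = XL (DL true d F) l := by
  rw [← T20_eq]
  induction l using List.twoStepInduction generalizing d F with
  | nil => simp [XL, T20, DL]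
  | singleton => simp [XL, T20, DL]
  | cons_cons s w l ih _ =>
    have h := V_eq' s w d
    simp only [Fintype.sum_bool] at h
    simp only [XL, T20, DL, Fintype.sum_bool, DL_add, DL_smul, ih, Bool.not_true, Bool.not_false,
      ← h]
    ring

/-- Append a fixed last letter `true`. -/
def QQ : (List Bool → ℝ) → List Bool → ℝ
  | _, [] => 0
  | F, [b] => if b then F [] else 0
  | F, a :: b :: l => QQ (fun l => F (a :: l)) (b :: l)

/-- Add fixed boundary values `false` in front and `true` at the end. -/
def PP (F : List Bool → ℝ) : List Bool → ℝ
  | [] => 0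
  | b :: l => if b then 0 else QQ F l

theorem QQ_concat (F : List Bool → ℝ) (l : List Bool) (b : Bool) :
    QQ F (l ++ [b]) = if b then F l else 0 := by
  induction l generalizing F with
  | nil => simp [QQ]
  | cons a l ih =>
    cases l with
    | nil => simp [QQ]
    | cons c l => simpa [QQ] using ih (fun l => F (a :: l))

theorem QQ_zero (l : List Bool) : QQ (fun _ => 0) l = 0 := by
  induction l with
  | nil => rfl
  | cons a l ih =>
    cases l with
    | nil => simp [QQ]
    | cons c l => simpa [QQ] using ih

theorem DL_zero (t d : Bool) (l : List Bool) : DL t d (fun _ => 0) l = 0 := by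
  simpa using DL_smul t d 0 (fun _ => 0) l

theorem QQ_add (F G : List Bool → ℝ) (l : List Bool) :
    QQ (fun l => F l + G l) l = QQ F l + QQ G l := by
  induction l generalizing F G with
  | nil => simp [QQ]
  | cons a l ih =>
    cases l with
    | nil => simp only [QQ]; split_ifs <;> simp
    | cons c l => simp only [QQ]; exact ih _ _

theorem QQ_smul (a : ℝ) (F : List Bool → ℝ) (l : List Bool) :
    QQ (fun l => a * F l) l = a * QQ F l := by
  induction l generalizing F with
  | nil => simp [QQ]
  | cons a l ih =>
    cases l with
    | nil => simp only [QQ]; split_ifs <;> simp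
    | cons c l => simp only [QQ]; exact ih _

theorem DL_congr_len (t d : Bool) (F G : List Bool → ℝ) (l : List Bool)
    (h : ∀ l', l'.length = l.length → F l' = G l') : DL t d F l = DL t d G l := by
  induction l generalizing t d F G with
  | nil => simp only [DL]; rw [h [] rfl]
  | cons b l ih =>
    simp only [DL]
    refine Finset.sum_congr rfl fun c _ => Finset.sum_congr rfl fun d' _ => ?_
    rw [ih]
    intro l' hl'
    exact h _ (by simp [hl'])

theorem DL_QQ (t d : Bool) (F : List Bool → ℝ) (l : List Bool)
    (hl : l.length % 2 = if t then 0 else 1) :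
    DL t d (QQ F) l = QQ (DL t d F) l := by
  induction l generalizing t d F with
  | nil => simp [DL, QQ]
  | cons b l ih =>
    cases l with
    | nil =>
      cases t
      · cases d <;> cases b <;> simp [DL, QQ, M6]
      · simp at hl
    | cons c l =>
      have h1 : ∀ e d', DL (!t) d' (fun l => QQ F (e :: l)) (c :: l)
          = QQ (DL (!t) d' (fun l => F (e :: l))) (c :: l) := by
        intro e d'
        rw [← ih]
        · apply DL_congr_len
          intro l' hl'
          cases l' with
          | nil => simp at hl'
          | cons _ _ => rfl
        · cases t <;> simp at hl ⊢ <;> omega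
      rw [DL]
      simp only [h1]
      simp only [QQ, Fintype.sum_bool, DL, ← QQ_add, ← QQ_smul]

theorem DL_PP (F : List Bool → ℝ) (l : List Bool) (hl : l.length % 2 = 0) :
    DL true false (PP F) l = PP (DL false false F) l := by
  cases l with
  | nil => simp [DL, PP]
  | cons b l =>
    have h := DL_QQ false false F l (by simp at hl ⊢; omega)
    cases b <;> simp [DL, PP, M6, DL_zero]
    exact h

/-- The triangle partition function as a function of the diagonal boundary values. -/
def Psi : ℕ → List Bool → ℝ
  | 0 => fun l => if l = [] then 1 else 0
  | m + 1 => T20 false (PP (Psi m))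

theorem XL_congr_len (F G : List Bool → ℝ) (l : List Bool)
    (h : ∀ l', l'.length = l.length → F l' = G l') : XL F l = XL G l := by
  induction l using List.twoStepInduction generalizing F G with
  | nil => simp only [XL]; exact h [] rfl
  | singleton => simp [XL]
  | cons_cons s w l ih _ =>
    simp only [XL]
    refine Finset.sum_congr rfl fun c _ => Finset.sum_congr rfl fun d' _ => ?_
    rw [ih]
    intro l' hl'
    exact h _ (by simp [hl'])

theorem QQ_congr_len (F G : List Bool → ℝ) (l : List Bool)
    (h : ∀ l', l'.length + 1 = l.length → F l' = G l') : QQ F l = QQ G l := by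
  rcases List.eq_nil_or_concat l with rfl | ⟨l, b, rfl⟩
  · rfl
  · rw [List.concat_eq_append] at *
    rw [QQ_concat, QQ_concat, h l (by simp)]

theorem PP_congr_len (F G : List Bool → ℝ) (l : List Bool)
    (h : ∀ l', l'.length + 2 = l.length → F l' = G l') : PP F l = PP G l := by
  cases l with
  | nil => rfl
  | cons b l =>
    simp only [PP]
    rw [QQ_congr_len F G]
    intro l' hl'
    exact h _ (by simp [← hl'])

theorem Psi_inv (m : ℕ) : ∀ l : List Bool, l.length % 2 = 0 →
    DL false false (Psi m) l = Psi m l := by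
  induction m with
  | zero =>
    intro l _
    cases l with
    | nil => simp [DL, Psi]
    | cons b l => simp [DL, Psi, DL_zero]
  | succ m ih =>
    intro l hl
    have e : Psi (m + 1) = XL (DL true false (PP (Psi m))) := by
      funext l; exact T20_eq _ _ _
    have e2 : ∀ l : List Bool, l.length % 2 = 0 → Psi (m + 1) l = XL (PP (Psi m)) l := by
      intro l hl
      rw [e]
      apply XL_congr_len
      intro l' hl'
      rw [DL_PP _ _ (by omega)]
      apply PP_congr_len
      intro l2 _
      exact ih _ (by omega)
    rw [DL_congr_len false false _ (XL (PP (Psi m))) l (fun l' h => e2 l' (by omega)), DL_XL, e]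

theorem Psi_succ (m : ℕ) (l : List Bool) (hl : l.length % 2 = 0) :
    Psi (m + 1) l = XL (PP (Psi m)) l := by
  show T20 _ _ _ = _
  rw [T20_eq]
  apply XL_congr_len
  intro l' hl'
  rw [DL_PP _ _ (by omega)]
  apply PP_congr_len
  intro l2 _
  exact Psi_inv m _ (by omega)

theorem XL_pair (a : Bool) (F : List Bool → ℝ) (l : List Bool) (n : ℕ) :
    XL F (List.replicate (2 * n) a ++ l)
      = √2 ^ n * XL (fun l => F (List.replicate (2 * n) a ++ l)) l := by
  induction n generalizing F with
  | zero => simp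
  | succ n ih =>
    have : 2 * (n + 1) = 2 * n + 1 + 1 := by ring
    rw [this]
    simp only [List.replicate_succ, List.cons_append, XL, ih]
    cases a <;> simp [X6] <;> ring

theorem Psi_even (n : ℕ) :
    Psi (2 * n + 2) (List.replicate (2 * n + 2) false ++ List.replicate (2 * n + 2) true)
      = 2 ^ (n + 1) *
        Psi (2 * n + 1) (List.replicate (2 * n + 1) false ++ List.replicate (2 * n + 1) true) := by
  rw [Psi_succ _ _ (by simp; omega)]
  have e1 : 2 * n + 2 = 2 * (n + 1) := by ring
  have h := XL_pair false (PP (Psi (2 * n + 1))) (List.replicate (2 * (n + 1)) true ++ []) (n + 1)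
  have h2 := XL_pair true (fun l => PP (Psi (2 * n + 1)) (List.replicate (2 * (n + 1)) false ++ l))
    [] (n + 1)
  rw [h2] at h
  rw [List.append_nil, ← e1] at h
  rw [h]
  simp only [XL, List.append_nil]
  rw [← mul_assoc, ← mul_pow, sq2]
  congr 1
  rw [List.replicate_succ, List.cons_append, PP, List.replicate_succ' (a := true),
    ← List.append_assoc, QQ_concat]
  simp

end Algebra

end TwentyV

namespace TwentyV

noncomputable section Bridge

/-- Update one edge. -/
def upd (o : Orientation) (e : (ℤ × ℤ) × Fin 3) (b : Bool) : Orientation :=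
  fun v d => if (v, d) = e then b else o v d

/-- Iterated sum over the values on a list of edges. -/
def S : List ((ℤ × ℤ) × Fin 3) → Orientation → (Orientation → ℝ) → ℝ
  | [], o, W => W o
  | e :: es, o, W => ∑ b, S es (upd o e b) W

theorem S_congr (es : List ((ℤ × ℤ) × Fin 3)) (o : Orientation) (W W' : Orientation → ℝ)
    (h : ∀ o' : Orientation, (∀ v d, (v, d) ∉ es → o' v d = o v d) → W o' = W' o') :
    S es o W = S es o W' := by
  induction es generalizing o with
  | nil => exact h o (fun _ _ _ => rfl)
  | cons e es ih =>
    simp only [S]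
    refine Finset.sum_congr rfl fun b _ => ih _ fun o' ho' => h o' fun v d hv => ?_
    simp only [List.mem_cons, not_or] at hv
    rw [ho' v d hv.2, upd, if_neg hv.1]

theorem S_append (es es' : List ((ℤ × ℤ) × Fin 3)) (o : Orientation) (W : Orientation → ℝ) :
    S (es ++ es') o W = S es o (fun o' => S es' o' W) := by
  induction es generalizing o with
  | nil => rfl
  | cons e es ih => simp only [List.cons_append, S, ih]

theorem S_smul (es : List ((ℤ × ℤ) × Fin 3)) (o : Orientation) (a : ℝ) (W : Orientation → ℝ) :
    S es o (fun o' => a * W o') = a * S es o W := by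
  induction es generalizing o with
  | nil => rfl
  | cons e es ih => simp only [S, ih, Finset.mul_sum]

open Classical in
theorem S_count (es : List ((ℤ × ℤ) × Fin 3)) (hes : es.Nodup) (o : Orientation)
    (P : Orientation → Prop) :
    {o' : Orientation | (∀ v d, (v, d) ∉ es → o' v d = o v d) ∧ P o'}.Finite ∧
    (({o' : Orientation | (∀ v d, (v, d) ∉ es → o' v d = o v d) ∧ P o'}.ncard : ℕ) : ℝ)
      = S es o (fun o' => if P o' then 1 else 0) := by
  induction es generalizing o with
  | nil =>
    have : {o' : Orientation | (∀ v d, (v, d) ∉ ([] : List ((ℤ × ℤ) × Fin 3)) → o' v d = o v d)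
        ∧ P o'} = if P o then {o} else ∅ := by
      ext o'
      simp only [List.not_mem_nil, not_false_eq_true, forall_const, Set.mem_ofPred_eq]
      have e : (∀ v d, o' v d = o v d) ↔ o' = o :=
        ⟨fun h => funext fun v => funext fun d => h v d, fun h => by simp [h]⟩
      rw [e]
      split_ifs with h
      · simp only [Set.mem_singleton_iff]
        exact ⟨fun x => x.1, fun x => ⟨x, x ▸ h⟩⟩
      · simp only [Set.mem_empty_iff_false, iff_false]
        rintro ⟨rfl, x⟩; exact h x
    rw [this]
    simp only [S]
    split_ifs <;> simp
  | cons e es ih =>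
    obtain ⟨he, hes⟩ := List.nodup_cons.1 hes
    have key : {o' : Orientation | (∀ v d, (v, d) ∉ e :: es → o' v d = o v d) ∧ P o'}
        = {o' | (∀ v d, (v, d) ∉ es → o' v d = upd o e true v d) ∧ P o'} ∪
          {o' | (∀ v d, (v, d) ∉ es → o' v d = upd o e false v d) ∧ P o'} := by
      ext o'
      simp only [Set.mem_ofPred_eq, Set.mem_union, ← or_and_right]
      apply and_congr_left
      intro _
      constructor
      · intro h
        have h' : ∀ v d, (v, d) ∉ es → o' v d = upd o e (o' e.1 e.2) v d := by
          intro v d hv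
          unfold upd
          split_ifs with h1
          · rw [← h1]
          · exact h v d (by simp [h1, hv])
        cases hb : o' e.1 e.2
        · right; rwa [hb] at h'
        · left; rwa [hb] at h'
      · intro h v d hv
        simp only [List.mem_cons, not_or] at hv
        rcases h with h | h <;> rw [h v d hv.2, upd, if_neg hv.1]
    have dis : Disjoint {o' | (∀ v d, (v, d) ∉ es → o' v d = upd o e true v d) ∧ P o'}
          {o' | (∀ v d, (v, d) ∉ es → o' v d = upd o e false v d) ∧ P o'} := by
      rw [Set.disjoint_left]
      rintro o' ⟨h1, _⟩ ⟨h2, _⟩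
      have a := h1 e.1 e.2 he
      rw [h2 e.1 e.2 he] at a
      simp [upd] at a
    obtain ⟨f1, c1⟩ := ih hes (upd o e true)
    obtain ⟨f2, c2⟩ := ih hes (upd o e false)
    rw [key]
    refine ⟨f1.union f2, ?_⟩
    rw [Set.ncard_union_eq dis f1 f2]
    push_cast
    rw [c1, c2]
    simp [S]

/-- The `k`-th vertex of the diagonal layer `x + y = c`. -/
def vtx (c : ℤ) (k : ℕ) : ℤ × ℤ := (-(k : ℤ), (k : ℤ) + c)

def str (c : ℤ) : ℕ → ℕ → Orientation → List Bool
  | _, 0, _ => []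
  | k, j + 1, o => o (-(k : ℤ), (k : ℤ) + c - 1) 1 :: o (-(k : ℤ) - 1, (k : ℤ) + c) 0
      :: str c (k + 1) j o

def ups (c : ℤ) : ℕ → ℕ → Orientation → List Bool
  | _, 0, _ => []
  | k, j + 1, o => o (vtx c k) 0 :: o (vtx c k) 1 :: ups c (k + 1) j o

def layE (c : ℤ) : ℕ → ℕ → List ((ℤ × ℤ) × Fin 3)
  | _, 0 => []
  | k, j + 1 => (vtx c k, 0) :: (vtx c k, 1) :: (vtx c (k + 1), 2) :: layE c (k + 1) j

def VW (c : ℤ) (k : ℕ) (o : Orientation) : ℝ :=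
  V (o (-(k : ℤ), (k : ℤ) + c - 1) 1) (o (-(k : ℤ) - 1, (k : ℤ) + c) 0) (o (vtx c k) 2)
    (o (vtx c k) 0) (o (vtx c k) 1) (o (vtx c (k + 1)) 2)

def layW (c : ℤ) : ℕ → ℕ → Orientation → ℝ
  | k, 0, o => if o (vtx c k) 2 = false then 1 else 0
  | k, j + 1, o => VW c k o * layW c (k + 1) j o

theorem str_congr (c : ℤ) (k j : ℕ) (o o' : Orientation)
    (h : ∀ v d, v.1 + v.2 = c - 1 → o v d = o' v d) : str c k j o = str c k j o' := by
  induction j generalizing k with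
  | zero => rfl
  | succ j ih =>
    simp only [str, ih]
    rw [h _ _ (by simp; ring), h _ _ (by simp; ring)]

theorem layW_congr (c : ℤ) (k j : ℕ) (o o' : Orientation)
    (h : ∀ v d, v.1 + v.2 ≤ c → o v d = o' v d) : layW c k j o = layW c k j o' := by
  induction j generalizing k with
  | zero => simp only [layW]; rw [h _ _ (by simp [vtx])]
  | succ j ih =>
    simp only [layW, ih, VW]
    congr 1
    congr 1 <;> apply h <;> simp only [vtx] <;> push_cast <;> omega

theorem mem_layE (c : ℤ) (k j : ℕ) (v : ℤ × ℤ) (d : Fin 3) :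
    (v, d) ∈ layE c k j ↔ v.1 + v.2 = c ∧
      ((d ≠ 2 ∧ (k : ℤ) ≤ -v.1 ∧ -v.1 < k + j) ∨ (d = 2 ∧ (k : ℤ) + 1 ≤ -v.1 ∧ -v.1 ≤ k + j)) := by
  obtain ⟨x, y⟩ := v
  induction j generalizing k with
  | zero =>
    simp only [layE, List.not_mem_nil, false_iff]
    push_cast
    rintro ⟨_, h | h⟩ <;> omega
  | succ j ih =>
    simp only [layE, List.mem_cons, ih, Prod.mk.injEq, vtx]
    push_cast
    fin_cases d <;> simp <;> omega

theorem layer_sum (c : ℤ) (k j : ℕ) (F : List Bool → ℝ) (o : Orientation) :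
    S (layE c k j) o (fun o' => layW c k j o' * F (ups c k j o'))
      = T20 (o (vtx c k) 2) F (str c k j o) := by
  induction j generalizing k F o with
  | zero =>
    simp only [layE, S, layW, ups, str, T20]
    split_ifs <;> simp
  | succ j ih =>
    simp only [layE, S, str, T20]
    refine Finset.sum_congr rfl fun e _ => Finset.sum_congr rfl fun n _ =>
      Finset.sum_congr rfl fun d' _ => ?_
    set o1 := upd (upd (upd o (vtx c k, 0) e) (vtx c k, 1) n) (vtx c (k + 1), 2) d' with ho1
    have hne : vtx c k ≠ vtx c (k + 1) := by
      intro h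
      have := congrArg Prod.fst h
      simp [vtx] at this
    have a0 : o1 (vtx c k) 0 = e := by simp [ho1, upd]
    have a1 : o1 (vtx c k) 1 = n := by simp [ho1, upd]
    have a2 : o1 (vtx c k) 2 = o (vtx c k) 2 := by simp [ho1, upd, hne]
    have a3 : o1 (vtx c (k + 1)) 2 = d' := by simp [ho1, upd]
    have a4 : ∀ v d, v.1 + v.2 = c - 1 → o1 v d = o v d := by
      rintro ⟨x, y⟩ d hv
      simp only at hv
      have h1 : (x, y) ≠ vtx c k := by
        intro h; simp only [vtx, Prod.mk.injEq] at h; omega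
      have h2 : (x, y) ≠ vtx c (k + 1) := by
        intro h; simp only [vtx, Prod.mk.injEq] at h; push_cast at h; omega
      simp [ho1, upd, h1, h2]
    have b1 := a4 (-(k : ℤ), (k : ℤ) + c - 1) 1 (by simp; ring)
    have b2 := a4 (-(k : ℤ) - 1, (k : ℤ) + c) 0 (by simp; ring)
    rw [S_congr _ _ _ (fun o' => V (o (-(k : ℤ), (k : ℤ) + c - 1) 1)
      (o (-(k : ℤ) - 1, (k : ℤ) + c) 0) (o (vtx c k) 2) e n d' *
      (layW c (k + 1) j o' * F (e :: n :: ups c (k + 1) j o')))]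
    · rw [S_smul, ih (k + 1) (fun l => F (e :: n :: l)) o1, a3, str_congr c (k + 1) j o1 o a4]
    · intro o' ho'
      simp only [layW, ups, VW]
      rw [ho' (vtx c k) 0, ho' (vtx c k) 1, ho' (vtx c k) 2, ho' (vtx c (k + 1)) 2,
        ho' (-(k : ℤ), (k : ℤ) + c - 1) 1, ho' (-(k : ℤ) - 1, (k : ℤ) + c) 0, a0, a1, a2, a3,
        b1, b2, mul_assoc]
      all_goals
        rw [mem_layE]; simp only [vtx]; push_cast; simp <;> omega

def triE : ℤ → ℕ → List ((ℤ × ℤ) × Fin 3)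
  | _, 0 => []
  | c, m + 1 => (vtx c 0, 2) :: (layE c 0 (m + 1) ++ triE (c + 1) m)

def triW : ℤ → ℕ → Orientation → ℝ
  | _, 0, _ => 1
  | c, m + 1, o => (if o (vtx c 0) 2 = false then 1 else 0) * (layW c 0 (m + 1) o *
      (if o (vtx c 0) 0 = false then 1 else 0) * (if o (vtx c m) 1 = true then 1 else 0)) *
      triW (c + 1) m o

theorem mem_triE (c : ℤ) (m : ℕ) (v : ℤ × ℤ) (d : Fin 3) :
    (v, d) ∈ triE c m ↔ v.1 ≤ 0 ∧ c ≤ v.1 + v.2 ∧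
      ((d ≠ 2 ∧ v.2 ≤ c + m - 1) ∨ (d = 2 ∧ v.2 ≤ c + m ∧ v.1 + v.2 ≤ c + m - 1)) := by
  obtain ⟨x, y⟩ := v
  induction m generalizing c with
  | zero =>
    simp only [triE, List.not_mem_nil, false_iff]
    push_cast
    rintro ⟨_, _, h | h⟩ <;> omega
  | succ m ih =>
    simp only [triE, List.mem_cons, List.mem_append, ih, mem_layE, Prod.mk.injEq, vtx]
    push_cast
    fin_cases d <;> simp <;> omega

theorem nodup_layE (c : ℤ) (k j : ℕ) : (layE c k j).Nodup := by
  induction j generalizing k with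
  | zero => simp [layE]
  | succ j ih =>
    simp only [layE, List.nodup_cons, List.mem_cons, mem_layE, ih, Prod.mk.injEq]
    simp [vtx]

theorem nodup_triE (c : ℤ) (m : ℕ) : (triE c m).Nodup := by
  induction m generalizing c with
  | zero => simp [triE]
  | succ m ih =>
    simp only [triE, List.nodup_cons, List.nodup_append, List.mem_append, nodup_layE, ih,
      mem_layE, mem_triE]
    refine ⟨by simp [vtx], trivial, trivial, ?_⟩
    rintro ⟨v, d⟩ h ⟨v', d'⟩ h' heq
    rw [mem_layE] at h
    rw [mem_triE] at h'
    simp only [Prod.mk.injEq] at heq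
    obtain ⟨rfl, rfl⟩ := heq
    omega

theorem ups_str (c : ℤ) (k j : ℕ) (o : Orientation) :
    ups c k (j + 1) o = o (vtx c k) 0 :: (str (c + 1) k j o ++ [o (vtx c (k + j)) 1]) := by
  induction j generalizing k with
  | zero => simp [ups, str]
  | succ j ih =>
    rw [ups, ih]
    simp only [str, List.cons_append]
    have e1 : ((-(k : ℤ), (k : ℤ) + (c + 1) - 1) : ℤ × ℤ) = vtx c k := by
      simp only [vtx, Prod.mk.injEq, true_and]; ring
    have e2 : ((-(k : ℤ) - 1, (k : ℤ) + (c + 1)) : ℤ × ℤ) = vtx c (k + 1) := by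
      simp only [vtx, Prod.mk.injEq]; push_cast; constructor <;> ring
    rw [e1, e2, show k + 1 + j = k + (j + 1) by ring]

theorem tri_sum (c : ℤ) (m : ℕ) (o : Orientation) :
    S (triE c m) o (triW c m) = Psi m (str c 0 m o) := by
  induction m generalizing c o with
  | zero => simp [triE, triW, S, Psi, str]
  | succ m ih =>
    have step : ∀ o1 : Orientation, S (triE (c + 1) m) o1 (triW c (m + 1))
        = (if o1 (vtx c 0) 2 = false then 1 else 0) *
          (layW c 0 (m + 1) o1 * PP (Psi m) (ups c 0 (m + 1) o1)) := by
      intro o1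
      rw [S_congr _ _ _ (fun o' => ((if o1 (vtx c 0) 2 = false then 1 else 0) *
        (layW c 0 (m + 1) o1 * (if o1 (vtx c 0) 0 = false then 1 else 0) *
          (if o1 (vtx c m) 1 = true then 1 else 0))) * triW (c + 1) m o')]
      · rw [S_smul, ih, ups_str, PP, QQ_concat, zero_add]
        cases o1 (vtx c 0) 0 <;> cases o1 (vtx c m) 1 <;> simp
      · intro o' ho'
        have hh : ∀ v d, v.1 + v.2 ≤ c → o' v d = o1 v d := by
          intro v d hv
          apply ho'
          rw [mem_triE]
          omega
        simp only [triW]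
        rw [layW_congr c 0 (m + 1) o' o1 hh, hh _ _ (by simp [vtx]), hh _ _ (by simp [vtx]),
          hh _ _ (by simp [vtx])]
    simp only [triE, S, S_append, step]
    have step2 : ∀ b, S (layE c 0 (m + 1)) (upd o (vtx c 0, 2) b)
        (fun o' => (if o' (vtx c 0) 2 = false then 1 else 0) *
          (layW c 0 (m + 1) o' * PP (Psi m) (ups c 0 (m + 1) o')))
        = (if b = false then 1 else 0) * T20 b (PP (Psi m)) (str c 0 (m + 1) o) := by
      intro b
      have hb : upd o (vtx c 0, 2) b (vtx c 0) 2 = b := by simp [upd]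
      rw [S_congr _ _ _ (fun o' => (if b = false then 1 else 0) *
          (layW c 0 (m + 1) o' * PP (Psi m) (ups c 0 (m + 1) o')))]
      · rw [S_smul, layer_sum, hb, str_congr c 0 (m + 1) (upd o (vtx c 0, 2) b) o]
        intro v d hv
        rw [upd, if_neg]
        intro h
        simp only [Prod.mk.injEq] at h
        rw [h.1] at hv
        simp only [vtx] at hv
        omega
      · intro o' ho'
        rw [ho', hb]
        rw [mem_layE]
        simp [vtx]
    simp only [step2]
    simp [Psi]

/-- Ice rule at a vertex. -/
def ice (c : ℤ) (k : ℕ) (o : Orientation) : Prop :=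
  (o (vtx c k) 0).toNat + (o (vtx c k) 1).toNat + (o (vtx c k) 2).toNat =
    (o (-(k : ℤ), (k : ℤ) + c - 1) 1).toNat + (o (-(k : ℤ) - 1, (k : ℤ) + c) 0).toNat +
    (o (vtx c (k + 1)) 2).toNat

open Classical in
theorem layW_eq (c : ℤ) (k j : ℕ) (o : Orientation) :
    layW c k j o = if (∀ i < j, ice c (k + i) o) ∧ o (vtx c (k + j)) 2 = false then 1 else 0 := by
  induction j generalizing k with
  | zero => simp [layW]
  | succ j ih =>
    rw [layW, ih]
    have e : (∀ i < j + 1, ice c (k + i) o) ↔ ice c k o ∧ ∀ i < j, ice c (k + 1 + i) o := by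
      rw [Nat.forall_lt_succ_left]
      simp only [add_zero, add_assoc, add_comm 1]
    have e2 : VW c k o = if ice c k o then 1 else 0 := by
      unfold VW V ice
      split_ifs <;> rfl
    simp only [e]
    rw [e2, show k + 1 + j = k + (j + 1) by ring]
    by_cases h : ice c k o <;> simp [h]

/-- All local conditions in one layer. -/
def layP (c : ℤ) (m : ℕ) (o : Orientation) : Prop :=
  o (vtx c 0) 2 = false ∧ (∀ i < m, ice c i o) ∧ o (vtx c m) 2 = false ∧
    o (vtx c 0) 0 = false ∧ o (vtx c (m - 1)) 1 = true

def triP (c : ℤ) (m : ℕ) (o : Orientation) : Prop :=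
  ∀ i < m, layP (c + i) (m - i) o

theorem triP_succ (c : ℤ) (m : ℕ) (o : Orientation) :
    triP c (m + 1) o ↔ layP c (m + 1) o ∧ triP (c + 1) m o := by
  unfold triP
  rw [Nat.forall_lt_succ_left]
  simp only [Nat.cast_zero, add_zero, Nat.sub_zero, Nat.cast_add, Nat.cast_one,
    Nat.add_sub_add_right]
  simp only [add_assoc, add_comm (1 : ℤ)]

open Classical in
theorem triW_eq (c : ℤ) (m : ℕ) (o : Orientation) :
    triW c m o = if triP c m o then 1 else 0 := by
  induction m generalizing c with
  | zero => simp [triW, triP]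
  | succ m ih =>
    rw [triW, ih, triP_succ, layW_eq, layP]
    simp only [zero_add, Nat.add_sub_cancel]
    by_cases h1 : o (vtx c 0) 2 = false <;> by_cases h2 : o (vtx c 0) 0 = false <;>
      by_cases h3 : o (vtx c m) 1 = true <;> by_cases h4 : triP (c + 1) m o <;>
      by_cases h5 : o (vtx c (m + 1)) 2 = false <;> simp [h1, h2, h3, h4, h5]

theorem inDeg_iff (c : ℤ) (k : ℕ) (o : Orientation) :
    inDeg o (vtx c k) = 3 ↔ ice c k o := by
  unfold inDeg ice
  have e0 : vtx c k - dir 0 = (-(k : ℤ) - 1, (k : ℤ) + c) := by simp [vtx, dir]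
  have e1 : vtx c k - dir 1 = (-(k : ℤ), (k : ℤ) + c - 1) := by simp [vtx, dir]
  have e2 : vtx c k - dir 2 = vtx c (k + 1) := by
    simp [vtx, dir]; constructor <;> ring
  rw [Finset.card_filter, Finset.card_filter, Fin.sum_univ_three, Fin.sum_univ_three, e0, e1, e2]
  cases o (vtx c k) 0 <;> cases o (vtx c k) 1 <;> cases o (vtx c k) 2 <;>
  cases o (-(k : ℤ) - 1, (k : ℤ) + c) 0 <;> cases o (-(k : ℤ), (k : ℤ) + c - 1) 1 <;>
  cases o (vtx c (k + 1)) 2 <;> simp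

/-- Background orientation. -/
def bg (m : ℕ) : Orientation := fun v d =>
  if v.1 + v.2 = -1 ∧ d = 1 ∧ 0 ≤ v.2 + 1 then decide ((m : ℤ) ≤ 2 * (v.2 + 1))
  else if v.1 + v.2 = -1 ∧ d = 0 ∧ 0 ≤ v.2 then decide ((m : ℤ) - 1 ≤ 2 * v.2)
  else true

theorem str_bg (m k j : ℕ) : str 0 k j (bg m) =
    (List.range' (2 * k) (2 * j)).map (fun i => decide (m ≤ i)) := by
  induction j generalizing k with
  | zero => simp [str]
  | succ j ih =>
    rw [str, ih, show 2 * (j + 1) = 2 * j + 1 + 1 by ring, List.range'_succ, List.range'_succ]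
    simp only [List.map_cons, bg]
    rw [show 2 * k + 1 + 1 = 2 * (k + 1) by ring]
    congr 1
    · rw [if_pos ⟨by ring, by trivial, by omega⟩]
      congr 1
      simp only [eq_iff_iff]; omega
    · congr 1
      rw [if_neg (by simp), if_pos ⟨by ring, by trivial, by omega⟩]
      congr 1
      simp only [eq_iff_iff]; omega

theorem str_bg' (m : ℕ) : str 0 0 m (bg m) =
    List.replicate m false ++ List.replicate m true := by
  rw [str_bg]
  apply List.ext_getElem
  · simp; ring
  · intro i h1 h2
    simp only [List.getElem_map, List.getElem_range', List.getElem_append, List.length_replicate,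
      List.getElem_replicate]
    split_ifs with h <;> simp <;> omega

theorem incident_iff (m : ℕ) (v : ℤ × ℤ) (d : Fin 3) :
    Incident m v d ↔ (v, d) ∈ triE 0 m ∨
      (v.1 + v.2 = -1 ∧ d = 1 ∧ 0 ≤ v.2 + 1 ∧ v.2 + 1 ≤ m - 1) ∨
      (v.1 + v.2 = -1 ∧ d = 0 ∧ 0 ≤ v.2 ∧ v.2 ≤ m - 1) := by
  obtain ⟨x, y⟩ := v
  rw [mem_triE]
  fin_cases d <;> simp [Incident, Tri, dir] <;> omega

theorem bound_iff (m : ℕ) (o : Orientation) :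
    (∀ v d, (v, d) ∉ triE 0 m → o v d = bg m v d) ↔
    ((∀ y : ℤ, 0 ≤ y → y ≤ (m : ℤ) - 1 →
      (o (-y - 1, y) 0 = true ↔ (m : ℤ) - 1 ≤ 2 * y) ∧
      (o (-y, y - 1) 1 = true ↔ (m : ℤ) ≤ 2 * y)) ∧
    (∀ v d, ¬ Incident m v d → o v d = true)) := by
  constructor
  · intro h
    refine ⟨fun y h0 h1 => ⟨?_, ?_⟩, fun v d hv => ?_⟩
    · rw [h _ _ (by rw [mem_triE]; simp only; omega), bg, if_neg (by simp), if_pos ⟨by simp only; ring, rfl, h0⟩]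
      simp
    · rw [h _ _ (by rw [mem_triE]; simp only; omega), bg, if_pos ⟨by simp only; ring, rfl, by simpa using h0⟩]
      simp
    · rw [incident_iff] at hv
      push Not at hv
      obtain ⟨h1, h2, h3⟩ := hv
      rw [h v d h1, bg]
      split_ifs with a b
      · have := h2 a.1 a.2.1 a.2.2
        simp; omega
      · have := h3 b.1 b.2.1 b.2.2
        simp; omega
      · rfl
  · rintro ⟨h1, h2⟩ v d hv
    by_cases hi : Incident m v d
    · rw [incident_iff] at hi
      obtain ⟨x, y⟩ := v
      rcases hi with hi | ⟨a, rfl, b, c⟩ | ⟨a, rfl, b, c⟩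
      · exact absurd hi hv
      · have := (h1 (y + 1) b c).2
        rw [bg, if_pos ⟨a, rfl, b⟩]
        simp only at a b c ⊢
        obtain rfl : x = -(y + 1) := by omega
        rw [add_sub_cancel_right] at this
        rw [Bool.eq_iff_iff, this]; simp
      · have := (h1 y b c).1
        rw [bg, if_neg (by simp), if_pos ⟨a, rfl, b⟩]
        simp only at a b c ⊢
        obtain rfl : x = -y - 1 := by omega
        rw [Bool.eq_iff_iff, this]; simp
    · rw [h2 v d hi, bg]
      rw [incident_iff] at hi
      push Not at hi
      obtain ⟨-, h2, h3⟩ := hi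
      split_ifs with a b
      · have := h2 a.1 a.2.1 a.2.2
        symm; simp; omega
      · have := h3 b.1 b.2.1 b.2.2
        symm; simp; omega
      · rfl

theorem triP_iff (m : ℕ) (o : Orientation) :
    triP 0 m o ↔ IceRule m o ∧
      (∀ y : ℤ, 0 ≤ y → y ≤ (m : ℤ) - 1 → o (0, y) 0 = false ∧ o (0, y) 2 = false) ∧
      (∀ x : ℤ, 1 - (m : ℤ) ≤ x → x ≤ 0 →
        o (x, (m : ℤ) - 1) 1 = true ∧ o (x - 1, (m : ℤ)) 2 = false) := by
  unfold triP layP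
  simp only [zero_add]
  constructor
  · intro h
    refine ⟨?_, ?_, ?_⟩
    · rintro ⟨x, y⟩ ⟨h1, h2, h3⟩
      simp only at h1 h2 h3
      have := (h (x + y).toNat (by omega)).2.1 (-x).toNat (by omega)
      rw [← inDeg_iff] at this
      convert this using 2
      simp only [vtx, Prod.mk.injEq]; omega
    · intro y h0 h1
      have := h y.toNat (by omega)
      have e : vtx (y.toNat : ℤ) 0 = (0, y) := by simp [vtx, h0]
      rw [e] at this
      exact ⟨this.2.2.2.1, this.1⟩
    · intro x h0 h1
      have := (h (m - 1 + x).toNat (by omega)).2.2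
      have e1 : vtx ((m - 1 + x).toNat : ℤ) (m - (m - 1 + x).toNat) = (x - 1, (m : ℤ)) := by
        simp only [vtx, Prod.mk.injEq]; omega
      have e2 : vtx ((m - 1 + x).toNat : ℤ) (m - (m - 1 + x).toNat - 1) = (x, (m : ℤ) - 1) := by
        simp only [vtx, Prod.mk.injEq]; omega
      rw [e1, e2] at this
      exact ⟨this.2.2, this.1⟩
  · rintro ⟨h1, h2, h3⟩ i hi
    have e : vtx (i : ℤ) 0 = (0, (i : ℤ)) := by simp [vtx]
    have e1 : vtx (i : ℤ) (m - i) = ((i + 1 - m : ℤ) - 1, (m : ℤ)) := by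
      simp only [vtx, Prod.mk.injEq]; omega
    have e2 : vtx (i : ℤ) (m - i - 1) = ((i + 1 - m : ℤ), (m : ℤ) - 1) := by
      simp only [vtx, Prod.mk.injEq]; omega
    rw [e, e1, e2]
    have a := h2 i (by omega) (by omega)
    have b := h3 (i + 1 - m : ℤ) (by omega) (by omega)
    refine ⟨a.2, fun k hk => ?_, b.2, a.1, b.1⟩
    rw [← inDeg_iff]
    apply h1
    simp only [Tri, vtx, Set.mem_ofPred_eq]; omega

theorem Z_eq (m : ℕ) :
    (Z m : ℝ) = Psi m (List.replicate m false ++ List.replicate m true) := by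
  classical
  rw [← str_bg', ← tri_sum]
  have : triW 0 m = fun o => if triP 0 m o then 1 else 0 := by
    funext o; exact triW_eq 0 m o
  rw [this]
  convert (S_count (triE 0 m) (nodup_triE 0 m) (bg m) (triP 0 m)).2 using 2
  unfold Z Config
  congr 1
  ext o
  simp only [Set.mem_ofPred_eq, bound_iff, triP_iff, DWBC3]
  tauto

end Bridge

end TwentyV

/-- For every integer `n ≥ 1`, the numbers of 20V configurations with
DWBC3 on triangles of consecutive sizes satisfy `Z_{2n}^{20V3} = 2^n · Z_{2n-1}^{20V3}`. -/
theorem Z20V3_even_eq_pow_two_mul_odd (n : ℕ) (hn : 1 ≤ n) :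
    TwentyV.Z (2 * n) = 2 ^ n * TwentyV.Z (2 * n - 1) := by
  obtain ⟨k, rfl⟩ : ∃ k, n = k + 1 := ⟨n - 1, by omega⟩
  have h := TwentyV.Psi_even k
  rw [← TwentyV.Z_eq, ← TwentyV.Z_eq] at h
  have e : 2 * (k + 1) - 1 = 2 * k + 1 := by omega
  rw [e]
  exact_mod_cast h
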